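/- Under the standing assumptions, x < ∏_{p prime, p ∣ z·(x^m − y^m)/(x − y)} (1 + 1/(p − 1)), where the product (taken in the real numbers) runs over the distinct prime divisors of z·(x^m − y^m)/(x − y). -/

import Mathlib

theorem x_lt_prod_primes (x y z m n : ℕ) (hx : 0 < x) (hy : 0 < y) (hz : 0 < z)
    (hm : 0 < m) (hn : 0 < n) (hxy : y < x) (hzxy : z ≤ x - y)
    (hgcd : Nat.gcd m n = 1) (hmn : n < m)
    (heq : Nat.totient (z * ((x ^ m - y ^ m) / (x - y))) =
      z * ((x ^ n - y ^ n) / (x - y))) :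
    (x : ℝ) < ∏ p ∈ (z * ((x ^ m - y ^ m) / (x - y))).primeFactors,
      (1 + 1 / ((p : ℝ) - 1)) := by
  have hA : (x ^ m - y ^ m) / (x - y) * (x - y) = x ^ m - y ^ m :=
    Nat.div_mul_cancel (Nat.sub_dvd_pow_sub_pow x y m)
  have hB : (x ^ n - y ^ n) / (x - y) * (x - y) = x ^ n - y ^ n :=
    Nat.div_mul_cancel (Nat.sub_dvd_pow_sub_pow x y n)
  generalize (x ^ m - y ^ m) / (x - y) = A at *
  generalize (x ^ n - y ^ n) / (x - y) = B at *
  have hd : 0 < x - y := by omega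
  have hle : ∀ k, y ^ k ≤ x ^ k := fun k => Nat.pow_le_pow_left hxy.le k
  have hlt : y ^ n < x ^ n := Nat.pow_lt_pow_left hxy hn.ne'
  have hmono : Monotone (fun k => (x:ℤ) ^ k - (y:ℤ) ^ k) := by
    apply monotone_nat_of_le_succ
    intro k
    have h1 : (y:ℤ) ^ k ≤ (x:ℤ) ^ k := by exact_mod_cast hle k
    have h2 : (1:ℤ) ≤ y := by exact_mod_cast hy
    have h3 : (y:ℤ) < x := by exact_mod_cast hxy
    have h4 : (0:ℤ) < (y:ℤ) ^ k := by positivity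
    simp only [pow_succ]
    nlinarith [mul_nonneg (sub_nonneg.2 h1) (sub_nonneg.2 h2), mul_nonneg (h4.le.trans h1) (sub_nonneg.2 h3.le)]
  have hmn' := hmono (Nat.succ_le_of_lt hmn)
  simp only [Nat.succ_eq_add_one, pow_succ] at hmn'
  have hBpos : 0 < B := by
    rcases Nat.eq_zero_or_pos B with h | h
    · subst h; omega
    · exact h
  have hAB : x * B < A := by
    apply lt_of_mul_lt_mul_right (a := x - y) _ (Nat.zero_le _)
    rw [hA, mul_assoc, hB]
    zify [hle m, hle n]
    have h3 : (y:ℤ) < x := by exact_mod_cast hxy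
    have h4 : (0:ℤ) < (y:ℤ) ^ n := by positivity
    nlinarith [mul_pos h4 (sub_pos.2 h3)]
  have ht := Nat.totient_eq_mul_prod_factors (z * A)
  have ht' : ((Nat.totient (z * A) : ℕ) : ℝ) =
      ((z * A : ℕ) : ℝ) * ∏ p ∈ (z * A).primeFactors, (1 - (p : ℝ)⁻¹) := by
    have h := congrArg (fun q : ℚ => (q : ℝ)) ht
    simp only [Rat.cast_mul, Rat.cast_prod, Rat.cast_sub, Rat.cast_inv, Rat.cast_natCast,
      Rat.cast_one] at h
    exact h
  have hPQ : (∏ p ∈ (z * A).primeFactors, (1 - (p : ℝ)⁻¹)) *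
      ∏ p ∈ (z * A).primeFactors, (1 + 1 / ((p : ℝ) - 1)) = 1 := by
    rw [← Finset.prod_mul_distrib]
    apply Finset.prod_eq_one
    intro p hp
    have : (1:ℝ) < p := by exact_mod_cast (Nat.prime_of_mem_primeFactors hp).one_lt
    have h1 : (p:ℝ) - 1 ≠ 0 := by linarith
    have h2 : (p:ℝ) ≠ 0 := by linarith
    field_simp
    ring
  have hN : ((z * A : ℕ) : ℝ) = ((z * B : ℕ) : ℝ) *
      ∏ p ∈ (z * A).primeFactors, (1 + 1 / ((p : ℝ) - 1)) := by
    rw [← heq, ht', mul_assoc, hPQ, mul_one]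
  have hfin : ((z * B : ℕ) : ℝ) * x < ((z * A : ℕ) : ℝ) := by
    have : z * B * x < z * A := by nlinarith
    exact_mod_cast this
  rw [hN] at hfin
  exact lt_of_mul_lt_mul_left hfin (Nat.cast_nonneg _)
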